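/- There exist constants C' > 0 and C_f > 0 such that every Q ∈ Sym₀ with dist(Q, N) > C_f satisfies f(Q) ≥ C' · |Q|⁴, where dist(Q, N) = inf over P ∈ N of |Q − P|. -/

import Mathlib

open Matrix

noncomputable section

/-- The space `Sym₀` of symmetric traceless `3 × 3` real matrices (as a subset of matrices). -/
def Sym0 : Set (Matrix (Fin 3) (Fin 3) ℝ) := {Q | Q.IsSymm ∧ Q.trace = 0}

/-- The norm `|Q| = √(tr Q²)`. -/
def nrm (Q : Matrix (Fin 3) (Fin 3) ℝ) : ℝ := Real.sqrt ((Q * Q).trace)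

/-- The Landau-de Gennes bulk potential
`f(Q) = C - a/2 tr(Q²) - b/3 tr(Q³) + c/4 (tr(Q²))²`. -/
def fLdG (a b c C : ℝ) (Q : Matrix (Fin 3) (Fin 3) ℝ) : ℝ :=
  C - a / 2 * (Q * Q).trace - b / 3 * (Q * Q * Q).trace + c / 4 * ((Q * Q).trace) ^ 2

/-- `s* = (b + √(b² + 24 a c))/(4c)`. -/
def sstar (a b c : ℝ) : ℝ := (b + Real.sqrt (b ^ 2 + 24 * a * c)) / (4 * c)

/-- The matrix `n ⊗ n` with entries `nᵢ nⱼ`. -/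
def outer (n : Fin 3 → ℝ) : Matrix (Fin 3) (Fin 3) ℝ := Matrix.of fun i j => n i * n j

/-- `n` is a unit vector of `ℝ³`. -/
def unitVec (n : Fin 3 → ℝ) : Prop := n 0 ^ 2 + n 1 ^ 2 + n 2 ^ 2 = 1

/-- The uniaxial matrix `s (n ⊗ n - Id/3)`. -/
def uniax (s : ℝ) (n : Fin 3 → ℝ) : Matrix (Fin 3) (Fin 3) ℝ :=
  s • (outer n - (1 / 3 : ℝ) • (1 : Matrix (Fin 3) (Fin 3) ℝ))

/-- The vacuum manifold `N = { s* (n ⊗ n - Id/3) : n ∈ S² }`. -/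
def Nset (a b c : ℝ) : Set (Matrix (Fin 3) (Fin 3) ℝ) :=
  {Q | ∃ n : Fin 3 → ℝ, unitVec n ∧ Q = uniax (sstar a b c) n}

/-- The distance `dist(Q, N) = inf_{P ∈ N} |Q - P|` measured in the norm `|·| = √(tr(·²))`. -/
def distN (a b c : ℝ) (Q : Matrix (Fin 3) (Fin 3) ℝ) : ℝ :=
  sInf ((fun P => nrm (Q - P)) '' Nset a b c)

/-- The trace of the square of a symmetric matrix is a sum of squares. -/
lemma trace_mul_self_nonneg {Q : Matrix (Fin 3) (Fin 3) ℝ} (hQ : Q.IsSymm) :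
    0 ≤ (Q * Q).trace := by
  nth_rewrite 1 [← hQ.eq]
  simp only [Matrix.trace, Matrix.diag, Matrix.mul_apply, Matrix.transpose_apply]
  exact Finset.sum_nonneg fun _ _ => Finset.sum_nonneg fun _ _ => mul_self_nonneg _

/-- For a traceless `3 × 3` matrix, `tr Q⁴ = (tr Q²)² / 2`. -/
lemma trace_pow_four_of_trace_eq_zero {Q : Matrix (Fin 3) (Fin 3) ℝ} (hQ : Q.trace = 0) :
    (Q * Q * (Q * Q)).trace = (Q * Q).trace ^ 2 / 2 := by
  have h : Q 2 2 = -Q 0 0 - Q 1 1 := by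
    rw [Matrix.trace_fin_three] at hQ
    linarith
  simp only [Matrix.trace_fin_three, Matrix.mul_apply, Fin.sum_univ_three, h]
  ring

/-- Young's inequality for the cubic term of the bulk potential. -/
lemma trace_cube_le {Q : Matrix (Fin 3) (Fin 3) ℝ} (hQ : Q ∈ Sym0) (b c : ℝ) :
    12 * b * c * (Q * Q * Q).trace ≤
      9 * c ^ 2 * (Q * Q).trace ^ 2 / 2 + 4 * b ^ 2 * (Q * Q).trace := by
  have hs : ((3 * c) • (Q * Q) - (2 * b) • Q).IsSymm := by
    simp [Matrix.IsSymm, Matrix.transpose_mul, hQ.1.eq]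
  have h := trace_mul_self_nonneg hs
  have h4 := trace_pow_four_of_trace_eq_zero hQ.2
  simp only [sub_mul, mul_sub, Matrix.smul_mul, Matrix.mul_smul, Matrix.trace_sub,
    Matrix.trace_smul, smul_eq_mul, h4, ← Matrix.mul_assoc Q Q Q] at h
  linarith

lemma uniax_isSymm (s : ℝ) (n : Fin 3 → ℝ) : (uniax s n).IsSymm := by
  ext i j
  simp [uniax, outer, Matrix.one_apply, mul_comm, eq_comm]

lemma trace_uniax_mul_self (s : ℝ) {n : Fin 3 → ℝ} (hn : unitVec n) :
    (uniax s n * uniax s n).trace = 2 / 3 * s ^ 2 := by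
  unfold unitVec at hn
  simp [uniax, outer, Matrix.trace_fin_three, Matrix.mul_apply, Fin.sum_univ_three,
    Matrix.one_apply]
  linear_combination s ^ 2 * (n 0 ^ 2 + n 1 ^ 2 + n 2 ^ 2 + 1 / 3) * hn

lemma trace_sub_mul_self_le {Q P : Matrix (Fin 3) (Fin 3) ℝ} (hQ : Q.IsSymm) (hP : P.IsSymm) :
    ((Q - P) * (Q - P)).trace ≤ 2 * (Q * Q).trace + 2 * (P * P).trace := by
  have h := trace_mul_self_nonneg (hQ.add hP)
  simp only [add_mul, mul_add, sub_mul, mul_sub, Matrix.trace_sub, Matrix.trace_add] at h ⊢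
  linarith

/-- The distance to the vacuum manifold is controlled by the norm. -/
lemma distN_le (a b c : ℝ) {Q : Matrix (Fin 3) (Fin 3) ℝ} (hQ : Q.IsSymm) :
    distN a b c Q ≤ Real.sqrt (2 * (Q * Q).trace + 2 * (2 / 3 * sstar a b c ^ 2)) := by
  have hn : unitVec ![1, 0, 0] := by simp [unitVec]
  have hbdd : BddBelow ((fun P => nrm (Q - P)) '' Nset a b c) :=
    ⟨0, by rintro _ ⟨P, -, rfl⟩; exact Real.sqrt_nonneg _⟩
  refine (csInf_le hbdd ⟨uniax (sstar a b c) ![1, 0, 0], ⟨_, hn, rfl⟩, rfl⟩).trans ?_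
  rw [← trace_uniax_mul_self _ hn]
  exact Real.sqrt_le_sqrt (trace_sub_mul_self_le hQ (uniax_isSymm _ _))

/-- There are constants `C' > 0` and `C_f > 0` such that `f(Q) ≥ C' |Q|⁴` whenever `Q ∈ Sym₀`
satisfies `dist(Q, N) > C_f`, where `C` is the constant normalizing `min f = 0` on `Sym₀`. -/
theorem statement4 (a b c C : ℝ) (ha : 0 < a) (hb : 0 < b) (hc : 0 < c)
    (hC0 : ∀ Q ∈ Sym0, 0 ≤ fLdG a b c C Q)
    (hC1 : ∃ Q ∈ Sym0, fLdG a b c C Q = 0) :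
    ∃ C' > (0 : ℝ), ∃ Cf > (0 : ℝ), ∀ Q ∈ Sym0,
      Cf < distN a b c Q → C' * nrm Q ^ 4 ≤ fLdG a b c C Q := by
  have hC : 0 ≤ C := by simpa [fLdG] using hC0 0 ⟨by simp [Matrix.IsSymm], by simp⟩
  set T := 16 * (a / 2 + b ^ 2 / (9 * c)) / c with hT
  have hTpos : 0 < T := by positivity
  refine ⟨c / 16, by positivity, Real.sqrt (2 * T + 2 * (2 / 3 * sstar a b c ^ 2)),
    Real.sqrt_pos.2 (by positivity), fun Q hQ hdist => ?_⟩
  have ht := trace_mul_self_nonneg hQ.1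
  have hlt := hdist.trans_le (distN_le a b c hQ.1)
  rw [Real.sqrt_lt_sqrt_iff (by positivity)] at hlt
  have hcube := trace_cube_le hQ b c
  have hn : nrm Q ^ 4 = (Q * Q).trace ^ 2 := by
    rw [nrm, show 4 = 2 * 2 from rfl, pow_mul, Real.sq_sqrt ht]
  rw [hn, fLdG]
  generalize (Q * Q).trace = t at *
  generalize (Q * Q * Q).trace = q at *
  have hq : b / 3 * q ≤ c * t ^ 2 / 8 + b ^ 2 / (9 * c) * t := by
    have hc36 : 0 < 36 * c := by positivity
    refine le_of_mul_le_mul_left ?_ hc36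
    have : 36 * c * (c * t ^ 2 / 8 + b ^ 2 / (9 * c) * t)
        = 9 * c ^ 2 * t ^ 2 / 2 + 4 * b ^ 2 * t := by
      field_simp
      ring
    linarith
  have hTt : (a / 2 + b ^ 2 / (9 * c)) * t ≤ c / 16 * t ^ 2 := by
    have : a / 2 + b ^ 2 / (9 * c) = c / 16 * T := by
      rw [hT]
      field_simp
    rw [this, sq, ← mul_assoc]
    have : T ≤ t := by linarith
    gcongr
  linarith


end
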